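/- Symmetrization of a nondegenerate Gaussian density: Let A be a symmetric positive definite d×d real matrix, b ∈ ℝ^d, and t > 0. Define f_{A,b}(t,x) = (2πt)^{-d/2} (det A)^{-1/2} exp(-⟨x - tb, A⁻¹(x - tb)⟩/(2t)) and set A* = (det A)^{1/d} I_d, where I_d is the d×d identity matrix. Then the symmetric decreasing rearrangement of the function x ↦ f_{A,b}(t,x) equals the function x ↦ f_{A*,0}(t,x) = (2πt)^{-d/2} (det A)^{-1/2} exp(-|x|²/(2t (det A)^{1/d})) at every point of ℝ^d; in particular, for every u > 0 the Lebesgue measures of {x : f_{A,b}(t,x) > u} and {x : f_{A*,0}(t,x) > u} coincide. -/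

import Mathlib

open MeasureTheory ENNReal Filter Topology
open scoped RealInnerProductSpace

/-- A nonnegative function on `ℝ^d` vanishes at infinity if all its positive
super-level sets have finite Lebesgue measure. -/
def VanishesAtInfinity {d : ℕ} (f : EuclideanSpace ℝ (Fin d) → ℝ) : Prop :=
  ∀ t : ℝ, 0 < t → volume {x : EuclideanSpace ℝ (Fin d) | t < f x} < ⊤

/-- Radius of the ball centered at the origin having the same volume as `A`. -/
noncomputable def symmRadius {d : ℕ} (A : Set (EuclideanSpace ℝ (Fin d))) : ℝ :=
  ((volume A / volume (Metric.ball (0 : EuclideanSpace ℝ (Fin d)) 1)).toReal) ^ ((1 : ℝ) / d)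

/-- `A*`: the open ball centered at the origin with the same Lebesgue measure as `A`. -/
noncomputable def ballStar {d : ℕ} (A : Set (EuclideanSpace ℝ (Fin d))) :
    Set (EuclideanSpace ℝ (Fin d)) :=
  Metric.ball 0 (symmRadius A)

/-- Symmetric decreasing rearrangement `f*` (with values in `[0,∞]`):
`f*(x) = ∫₀^∞ 1_{{f>t}*}(x) dt`. -/
noncomputable def symmRearrange {d : ℕ} (f : EuclideanSpace ℝ (Fin d) → ℝ)
    (x : EuclideanSpace ℝ (Fin d)) : ℝ≥0∞ :=
  ∫⁻ t in Set.Ioi (0 : ℝ), (ballStar {y | t < f y}).indicator (fun _ => (1 : ℝ≥0∞)) x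

/-- The quadratic form `⟨x, M x⟩` of a `d × d` matrix. -/
noncomputable def quadForm {d : ℕ} (M : Matrix (Fin d) (Fin d) ℝ)
    (x : EuclideanSpace ℝ (Fin d)) : ℝ :=
  ∑ i, ∑ j, x i * M i j * x j

/-- The nondegenerate Gaussian density
`f_{A,b}(t,x) = (2πt)^{-d/2} (det A)^{-1/2} exp(-⟨x-tb, A⁻¹(x-tb)⟩/(2t))`. -/
noncomputable def gaussDensity {d : ℕ} (A : Matrix (Fin d) (Fin d) ℝ)
    (b : EuclideanSpace ℝ (Fin d)) (t : ℝ) (x : EuclideanSpace ℝ (Fin d)) : ℝ :=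
  (2 * Real.pi * t) ^ (-(d : ℝ) / 2) * (Real.sqrt A.det)⁻¹ *
    Real.exp (-(quadForm A⁻¹ (x - t • b)) / (2 * t))

/-- The symmetrized Gaussian density
`f_{A*,0}(t,x) = (2πt)^{-d/2} (det A)^{-1/2} exp(-|x|²/(2t (det A)^{1/d}))`,
where `A* = (det A)^{1/d} I_d`. -/
noncomputable def gaussStarDensity {d : ℕ} (A : Matrix (Fin d) (Fin d) ℝ) (t : ℝ)
    (x : EuclideanSpace ℝ (Fin d)) : ℝ :=
  (2 * Real.pi * t) ^ (-(d : ℝ) / 2) * (Real.sqrt A.det)⁻¹ *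
    Real.exp (-(‖x‖ ^ 2) / (2 * t * A.det ^ ((1 : ℝ) / d)))

open scoped MatrixOrder in
/-- A positive definite quadratic form is the squared norm of an invertible linear map. -/
theorem exists_linearMap_norm_sq_eq_quadForm_inv {d : ℕ} {A : Matrix (Fin d) (Fin d) ℝ}
    (hA : A.PosDef) :
    ∃ L : EuclideanSpace ℝ (Fin d) →ₗ[ℝ] EuclideanSpace ℝ (Fin d),
      (∀ x, ‖L x‖ ^ 2 = quadForm A⁻¹ x) ∧ LinearMap.det L ^ 2 = A.det⁻¹ := by
  obtain ⟨B, hB⟩ := CStarAlgebra.nonneg_iff_eq_star_mul_self.mp hA.inv.posSemidef.nonneg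
  rw [Matrix.star_eq_conjTranspose, Matrix.conjTranspose_eq_transpose_of_trivial] at hB
  refine ⟨Matrix.toEuclideanLin B, fun x => ?_, ?_⟩
  · have h : quadForm A⁻¹ x = x.ofLp ⬝ᵥ (A⁻¹.mulVec x.ofLp) := by
      simp only [quadForm, dotProduct, Matrix.mulVec, Finset.mul_sum, mul_assoc]
    rw [h, hB, ← Matrix.mulVec_mulVec, Matrix.dotProduct_mulVec, Matrix.vecMul_transpose,
      EuclideanSpace.real_norm_sq_eq]
    simp only [dotProduct, Matrix.ofLp_toLpLin, Matrix.toLin'_apply, sq]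
  · rw [Matrix.toEuclideanLin_eq_toLin_orthonormal, LinearMap.det_toLin, sq,
      ← Ring.inverse_eq_inv', ← Matrix.det_nonsing_inv, hB, Matrix.det_mul, Matrix.det_transpose]

/-- Two linear maps with determinants of the same size pull a set back to sets of equal volume,
up to translation. -/
theorem volume_preimage_linearMap_sub_eq {d : ℕ}
    {L M : EuclideanSpace ℝ (Fin d) →ₗ[ℝ] EuclideanSpace ℝ (Fin d)}
    (hM : LinearMap.det M ≠ 0) (h : |LinearMap.det L| = |LinearMap.det M|)
    (v : EuclideanSpace ℝ (Fin d)) (S : Set (EuclideanSpace ℝ (Fin d))) :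
    volume {x | L (x - v) ∈ S} = volume {x | M x ∈ S} := by
  have hL : LinearMap.det L ≠ 0 := abs_pos.mp (h ▸ abs_pos.mpr hM)
  have htrans : volume {x | L (x - v) ∈ S} = volume (L ⁻¹' S) := by
    simpa only [sub_eq_add_neg] using! measure_preimage_add_right volume (-v) (L ⁻¹' S)
  have hpre : volume {x | M x ∈ S} = volume (M ⁻¹' S) := rfl
  rw [htrans, hpre, Measure.addHaar_preimage_linearMap _ hL,
    Measure.addHaar_preimage_linearMap _ hM, abs_inv, abs_inv, h]

theorem volume_superlevel_gaussDensity {d : ℕ} (hd : 1 ≤ d)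
    {A : Matrix (Fin d) (Fin d) ℝ} (hA : A.PosDef)
    (b : EuclideanSpace ℝ (Fin d)) (t u : ℝ) :
    volume {x : EuclideanSpace ℝ (Fin d) | u < gaussDensity A b t x} =
      volume {x : EuclideanSpace ℝ (Fin d) | u < gaussStarDensity A t x} := by
  obtain ⟨L, hL, hdet⟩ := exists_linearMap_norm_sq_eq_quadForm_inv hA
  have hD : 0 < A.det := hA.det_pos
  have hd' : (d : ℝ) ≠ 0 := by positivity
  set c : ℝ := Real.sqrt (A.det ^ ((1 : ℝ) / d))⁻¹ with hc
  have hq : 0 < A.det ^ ((1 : ℝ) / d) := Real.rpow_pos_of_pos hD _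
  have hc2 : c ^ 2 = (A.det ^ ((1 : ℝ) / d))⁻¹ := Real.sq_sqrt (inv_pos.mpr hq).le
  have hc0 : 0 < c := Real.sqrt_pos.mpr (inv_pos.mpr hq)
  have hdetM : LinearMap.det (c • (LinearMap.id :
      EuclideanSpace ℝ (Fin d) →ₗ[ℝ] EuclideanSpace ℝ (Fin d))) = c ^ d := by
    simp
  have hpow : (c ^ d) ^ 2 = A.det⁻¹ := by
    rw [← pow_mul, mul_comm, pow_mul, hc2, inv_pow, ← Real.rpow_natCast, ← Real.rpow_mul hD.le,
      one_div_mul_cancel hd', Real.rpow_one]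
  have key := volume_preimage_linearMap_sub_eq (L := L) (M := c • LinearMap.id)
    (by rw [hdetM]; positivity) (by rw [hdetM, ← sq_eq_sq_iff_abs_eq_abs, hdet, hpow]) (t • b)
    {y | u < (2 * Real.pi * t) ^ (-(d : ℝ) / 2) * (Real.sqrt A.det)⁻¹ *
      Real.exp (-(‖y‖ ^ 2) / (2 * t))}
  convert key using 2
  · ext x
    simp only [gaussDensity, Set.mem_ofPred_eq, hL]
  · ext x
    have hnorm : ‖(c • (LinearMap.id : EuclideanSpace ℝ (Fin d) →ₗ[ℝ] _)) x‖ ^ 2 =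
        (A.det ^ ((1 : ℝ) / d))⁻¹ * ‖x‖ ^ 2 := by
      rw [LinearMap.smul_apply, LinearMap.id_apply, norm_smul, mul_pow, Real.norm_eq_abs, sq_abs,
        hc2]
    have hexp : -(‖x‖ ^ 2) / (2 * t * A.det ^ ((1 : ℝ) / d)) =
        -((A.det ^ ((1 : ℝ) / d))⁻¹ * ‖x‖ ^ 2) / (2 * t) := by
      simp only [div_eq_mul_inv, mul_inv]
      ring
    simp only [gaussStarDensity, Set.mem_ofPred_eq, hnorm, hexp]

theorem symmRadius_ball {d : ℕ} (hd : 1 ≤ d) {r : ℝ} (hr : 0 ≤ r) :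
    symmRadius (Metric.ball (0 : EuclideanSpace ℝ (Fin d)) r) = r := by
  have : Nonempty (Fin d) := ⟨⟨0, hd⟩⟩
  have hd' : (d : ℝ) ≠ 0 := by positivity
  have h0 : volume (Metric.ball (0 : EuclideanSpace ℝ (Fin d)) 1) ≠ 0 :=
    (Metric.measure_ball_pos _ _ one_pos).ne'
  rw [symmRadius, Measure.addHaar_ball _ _ hr, finrank_euclideanSpace_fin,
    ENNReal.mul_div_cancel_right h0 measure_ball_lt_top.ne, ENNReal.toReal_ofReal (by positivity),
    ← Real.rpow_natCast, ← Real.rpow_mul hr, mul_one_div_cancel hd', Real.rpow_one]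

/-- Superlevel sets of a centered isotropic Gaussian are centered open balls. -/
theorem exists_superlevel_gaussian_eq_ball {d : ℕ} {C s u : ℝ} (hC : 0 < C) (hs : 0 < s)
    (hu : 0 < u) :
    ∃ r : ℝ, 0 ≤ r ∧ {x : EuclideanSpace ℝ (Fin d) | u < C * Real.exp (-(‖x‖ ^ 2) / s)} =
      Metric.ball 0 r := by
  refine ⟨Real.sqrt (-(s * Real.log (u / C))), Real.sqrt_nonneg _, ?_⟩
  ext x
  rw [Set.mem_ofPred_eq, mem_ball_zero_iff, Real.lt_sqrt (norm_nonneg x), ← div_lt_iff₀' hC,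
    ← Real.log_lt_iff_lt_exp (div_pos hu hC), lt_div_iff₀ hs]
  constructor <;> intro h <;> linarith

theorem ballStar_superlevel_gaussStarDensity {d : ℕ} (hd : 1 ≤ d)
    {A : Matrix (Fin d) (Fin d) ℝ} (hA : A.PosDef) {t u : ℝ} (ht : 0 < t) (hu : 0 < u) :
    ballStar {x | u < gaussStarDensity A t x} = {x | u < gaussStarDensity A t x} := by
  have hD : 0 < A.det := hA.det_pos
  have hC : 0 < (2 * Real.pi * t) ^ (-(d : ℝ) / 2) * (Real.sqrt A.det)⁻¹ := by positivity
  have hs : 0 < 2 * t * A.det ^ ((1 : ℝ) / d) := by positivity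
  obtain ⟨r, hr, h⟩ := exists_superlevel_gaussian_eq_ball (d := d) hC hs hu
  simp only [gaussStarDensity]
  rw [h, ballStar, symmRadius_ball hd hr]

theorem ballStar_congr {d : ℕ} {S T : Set (EuclideanSpace ℝ (Fin d))}
    (h : volume S = volume T) : ballStar S = ballStar T := by
  rw [ballStar, ballStar, symmRadius, symmRadius, h]

/-- **Symmetrization of a nondegenerate Gaussian density.** -/
theorem gaussian_density_rearrangement {d : ℕ} (hd : 1 ≤ d)
    (A : Matrix (Fin d) (Fin d) ℝ) (hA : A.PosDef)
    (b : EuclideanSpace ℝ (Fin d)) (t : ℝ) (ht : 0 < t) :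
    (∀ x, symmRearrange (gaussDensity A b t) x = ENNReal.ofReal (gaussStarDensity A t x)) ∧
      ∀ u : ℝ, 0 < u →
        volume {x : EuclideanSpace ℝ (Fin d) | u < gaussDensity A b t x} =
          volume {x : EuclideanSpace ℝ (Fin d) | u < gaussStarDensity A t x} := by
  refine ⟨fun x => ?_, fun u _ => volume_superlevel_gaussDensity hd hA b t u⟩
  have hstar : ∀ u ∈ Set.Ioi (0 : ℝ),
      (ballStar {y | u < gaussDensity A b t y}).indicator (fun _ => (1 : ℝ≥0∞)) x =
        (Set.Iio (gaussStarDensity A t x)).indicator (fun _ => (1 : ℝ≥0∞)) u := by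
    intro u hu
    rw [ballStar_congr (volume_superlevel_gaussDensity hd hA b t u),
      ballStar_superlevel_gaussStarDensity hd hA ht hu]
    rfl
  rw [symmRearrange, setLIntegral_congr_fun measurableSet_Ioi hstar,
    lintegral_indicator measurableSet_Iio, setLIntegral_const, one_mul,
    Measure.restrict_apply measurableSet_Iio, Set.Iio_inter_Ioi, Real.volume_Ioo, sub_zero]
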